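/- For a positive-definite matrix Σ ∈ R^{D×D} with mean-zero Gaussian, the divergence KL(N(m, Σ) ‖ N(0, I)) decomposes as KL(N(m, Σ) ‖ N(m, Diag(Σ))) + KL(N(m, Diag(Σ)) ‖ N(0, I)), where Diag(Σ) is the diagonal matrix with the same diagonal as Σ. -/

import Mathlib

open MeasureTheory Matrix

/-- Density of the multivariate Gaussian `N(m, Σ)` on `ℝ^D`. -/
noncomputable def gaussianDensity {D : ℕ} (m : Fin D → ℝ) (S : Matrix (Fin D) (Fin D) ℝ)
    (x : Fin D → ℝ) : ℝ :=
  (Real.sqrt ((2 * Real.pi) ^ D * S.det))⁻¹ *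
    Real.exp (-(1 / 2) * dotProduct (x - m) (S⁻¹ *ᵥ (x - m)))

/-- The multivariate Gaussian measure `N(m, Σ)` on `ℝ^D`. -/
noncomputable def gaussianMeasure {D : ℕ} (m : Fin D → ℝ) (S : Matrix (Fin D) (Fin D) ℝ) :
    Measure (Fin D → ℝ) :=
  volume.withDensity fun x => ENNReal.ofReal (gaussianDensity m S x)

/-- Kullback-Leibler divergence `KL(p ‖ q) = ∫ log (dp/dq) dp`. -/
noncomputable def klDiv' {D : ℕ} (p q : Measure (Fin D → ℝ)) : ℝ :=
  ∫ x, Real.log ((p.rnDeriv q x).toReal) ∂p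

open ProbabilityTheory in
/-- Finite products commute with real densities. -/
lemma pi_withDensity_ofReal {ι : Type*} [Fintype ι] {E : ι → Type*}
    [∀ i, MeasurableSpace (E i)] (μ : ∀ i, Measure (E i)) [∀ i, SigmaFinite (μ i)]
    {f : ∀ i, E i → ℝ} (hf : ∀ i, Integrable (f i) (μ i)) (hf0 : ∀ i x, 0 ≤ f i x) :
    Measure.pi (fun i => (μ i).withDensity fun x => ENNReal.ofReal (f i x)) =
      (Measure.pi μ).withDensity fun x => ENNReal.ofReal (∏ i, f i (x i)) := by
  have (i : ι) : SigmaFinite ((μ i).withDensity fun x => ENNReal.ofReal (f i x)) :=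
    SigmaFinite.withDensity_ofReal (f i)
  refine Measure.pi_eq fun s hs => ?_
  rw [withDensity_apply _ (MeasurableSet.univ_pi hs), Measure.restrict_pi_pi,
    ← ofReal_integral_eq_lintegral_ofReal
      (Integrable.fintype_prod_dep fun i => (hf i).restrict)
      (ae_of_all _ fun x => Finset.prod_nonneg fun i _ => hf0 i (x i)),
    integral_fintype_prod_eq_prod,
    ENNReal.ofReal_prod_of_nonneg fun i _ => integral_nonneg (hf0 i)]
  refine Finset.prod_congr rfl fun i _ => ?_
  rw [withDensity_apply _ (hs i), ofReal_integral_eq_lintegral_ofReal (hf i).restrict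
    (ae_of_all _ (hf0 i))]

section Gaussian

variable {D : ℕ} {S T : Matrix (Fin D) (Fin D) ℝ}

lemma gaussianDensity_pos (m : Fin D → ℝ) (hS : S.PosDef) (x : Fin D → ℝ) :
    0 < gaussianDensity m S x := by
  have := hS.det_pos
  unfold gaussianDensity
  positivity

lemma continuous_gaussianDensity (m : Fin D → ℝ) (S : Matrix (Fin D) (Fin D) ℝ) :
    Continuous (gaussianDensity m S) := by
  unfold gaussianDensity
  fun_prop

lemma log_gaussianDensity (m : Fin D → ℝ) (hS : S.PosDef) (x : Fin D → ℝ) :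
    Real.log (gaussianDensity m S x) =
      -Real.log (Real.sqrt ((2 * Real.pi) ^ D * S.det)) -
        1 / 2 * dotProduct (x - m) (S⁻¹ *ᵥ (x - m)) := by
  have := hS.det_pos
  unfold gaussianDensity
  rw [Real.log_mul (by positivity) (Real.exp_pos _).ne', Real.log_inv, Real.log_exp]
  ring

open ProbabilityTheory in
lemma gaussianMeasure_zero_one :
    gaussianMeasure (0 : Fin D → ℝ) 1 = Measure.pi fun _ => gaussianReal 0 1 := by
  have h : (fun _ : Fin D => gaussianReal 0 1) =
      fun _ => volume.withDensity fun x => ENNReal.ofReal (gaussianPDFReal 0 1 x) := by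
    funext i
    rw [gaussianReal_of_var_ne_zero _ one_ne_zero, gaussianPDF_def]
  rw [h, pi_withDensity_ofReal _ (fun _ => integrable_gaussianPDFReal 0 1)
    (fun _ => gaussianPDFReal_nonneg 0 1), gaussianMeasure, volume_pi]
  congr with x
  congr 1
  simp only [gaussianDensity, gaussianPDFReal, Finset.prod_mul_distrib, ← Real.exp_sum]
  simp only [det_one, mul_one, sub_zero, inv_one, one_mulVec, NNReal.coe_one,
    Finset.prod_const, Finset.card_univ, Fintype.card_fin, dotProduct]
  congr 1
  · rw [inv_pow, Real.sqrt_eq_rpow, Real.sqrt_eq_rpow, ← Real.rpow_mul_natCast (by positivity),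
      ← Real.rpow_natCast, ← Real.rpow_mul (by positivity), mul_comm (D : ℝ)]
  · rw [Finset.mul_sum]
    congr 1
    exact Finset.sum_congr rfl fun i _ => by ring

lemma gaussianMeasure_eq_map {A : Matrix (Fin D) (Fin D) ℝ} (m : Fin D → ℝ)
    (hA : A.det ≠ 0) (hS : A * Aᵀ = S) :
    gaussianMeasure m S = (gaussianMeasure 0 1).map fun z => m + A *ᵥ z := by
  have hT : Measurable fun z => m + A *ᵥ z :=
    (by fun_prop : Continuous fun z => m + A *ᵥ z).measurable
  have hvol : (volume : Measure (Fin D → ℝ)).map (fun z => m + A *ᵥ z) =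
      ENNReal.ofReal |A.det⁻¹| • volume := by
    have : (fun z => m + A *ᵥ z) = (fun z => m + z) ∘ toLin' A := by ext; simp
    rw [this, ← Measure.map_map (by fun_prop)
      (toLin' A).continuous_of_finiteDimensional.measurable,
      Real.map_matrix_volume_pi_eq_smul_volume_pi hA, Measure.map_smul, map_add_left_eq_self]
  have hdet : S.det = A.det ^ 2 := by rw [← hS, det_mul, det_transpose, sq]
  have hquad (z : Fin D → ℝ) : dotProduct (A *ᵥ z) (S⁻¹ *ᵥ (A *ᵥ z)) = dotProduct z z := by
    have hu : IsUnit A.det := hA.isUnit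
    have hut : IsUnit Aᵀ.det := by rwa [det_transpose]
    rw [← hS, Matrix.mul_inv_rev, mulVec_mulVec, Matrix.mul_assoc, nonsing_inv_mul _ hu,
      Matrix.mul_one, dotProduct_comm, dotProduct_mulVec, ← mulVec_transpose, mulVec_mulVec,
      mul_nonsing_inv _ hut, one_mulVec]
  have hdens (z : Fin D → ℝ) :
      gaussianDensity 0 1 z = |A.det| * gaussianDensity m S (m + A *ᵥ z) := by
    have := abs_pos.mpr hA
    simp only [gaussianDensity, add_sub_cancel_left, hquad, hdet, det_one, sub_zero, inv_one,
      one_mulVec, mul_one]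
    rw [Real.sqrt_mul (by positivity), Real.sqrt_sq_eq_abs]
    field_simp
  have hmeas : Measurable fun x => ENNReal.ofReal (gaussianDensity m S x) :=
    (continuous_gaussianDensity m S).measurable.ennreal_ofReal
  ext s hs
  rw [Measure.map_apply hT hs, gaussianMeasure, gaussianMeasure, withDensity_apply _ hs,
    withDensity_apply _ (hT hs)]
  simp_rw [hdens, ENNReal.ofReal_mul (abs_nonneg _)]
  rw [lintegral_const_mul' _ _ ENNReal.ofReal_ne_top, ← setLIntegral_map hs hmeas hT, hvol,
    Measure.restrict_smul, lintegral_smul_measure, smul_eq_mul, ← mul_assoc,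
    ← ENNReal.ofReal_mul (abs_nonneg _), ← abs_mul, mul_inv_cancel₀ hA]
  simp

open ProbabilityTheory MatrixOrder in
lemma gaussianMeasure_eq_map_multivariateGaussian (m : Fin D → ℝ) (hS : S.PosDef) :
    gaussianMeasure m S =
      (multivariateGaussian (WithLp.toLp 2 m) S).map WithLp.ofLp := by
  have hmul : CFC.sqrt S * CFC.sqrt S = S := CFC.sqrt_mul_sqrt_self _ hS.posSemidef.nonneg
  have hsymm : (CFC.sqrt S)ᵀ = CFC.sqrt S := (CFC.sqrt_nonneg S).isSelfAdjoint
  have hdet : (CFC.sqrt S).det ≠ 0 := fun h => hS.det_pos.ne' (by rw [← hmul, det_mul, h, zero_mul])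
  rw [gaussianMeasure_eq_map m hdet (by rw [hsymm, hmul]), gaussianMeasure_zero_one,
    multivariateGaussian, ← map_pi_eq_stdGaussian, Measure.map_map (by fun_prop) (by fun_prop),
    Measure.map_map (by fun_prop) (by fun_prop)]
  rfl

lemma isProbabilityMeasure_gaussianMeasure (m : Fin D → ℝ) (hS : S.PosDef) :
    IsProbabilityMeasure (gaussianMeasure m S) := by
  rw [gaussianMeasure_eq_map_multivariateGaussian m hS]
  exact Measure.isProbabilityMeasure_map (Measurable.aemeasurable (by fun_prop))

open ProbabilityTheory in
/-- The coordinates of `N(m, S)` have law `N(m i, S i i)`. -/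
lemma measurePreserving_eval_gaussianMeasure (m : Fin D → ℝ) (hS : S.PosDef) (i : Fin D) :
    MeasurePreserving (fun x => x i) (gaussianMeasure m S)
      (gaussianReal (m i) (S i i).toNNReal) where
  measurable := by fun_prop
  map_eq := by
    rw [gaussianMeasure_eq_map_multivariateGaussian m hS,
      Measure.map_map (by fun_prop) (by fun_prop)]
    exact (measurePreserving_eval_multivariateGaussian hS.posSemidef).map_eq

open ProbabilityTheory in
lemma memLp_eval_gaussianMeasure (m : Fin D → ℝ) (hS : S.PosDef) (i : Fin D) :
    MemLp (fun x => x i) 2 (gaussianMeasure m S) :=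
  (IsGaussian.memLp_two_id (μ := gaussianReal (m i) (S i i).toNNReal)).comp_measurePreserving
    (measurePreserving_eval_gaussianMeasure m hS i)

lemma integrable_quadratic_gaussianMeasure (m : Fin D → ℝ) (hS : S.PosDef) (c : Fin D → ℝ)
    (M : Matrix (Fin D) (Fin D) ℝ) :
    Integrable (fun x => dotProduct (x - c) (M *ᵥ (x - c))) (gaussianMeasure m S) := by
  have := isProbabilityMeasure_gaussianMeasure m hS
  have h (i : Fin D) : MemLp (fun x => x i - c i) 2 (gaussianMeasure m S) :=
    (memLp_eval_gaussianMeasure m hS i).sub (memLp_const (c i))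
  simp only [dotProduct, mulVec, Pi.sub_apply]
  exact integrable_finsetSum _ fun i _ =>
    (h i).integrable_mul (memLp_finsetSum _ fun j _ => (h j).const_mul (M i j))

lemma integrable_log_gaussianDensity (m m' : Fin D → ℝ) (hS : S.PosDef) (hT : T.PosDef) :
    Integrable (fun x => Real.log (gaussianDensity m' T x)) (gaussianMeasure m S) := by
  have := isProbabilityMeasure_gaussianMeasure m hS
  simp_rw [log_gaussianDensity m' hT]
  exact (integrable_const _).sub
    ((integrable_quadratic_gaussianMeasure m hS m' T⁻¹).const_mul _)

lemma klDiv'_gaussianMeasure (m m' : Fin D → ℝ) (hS : S.PosDef) (hT : T.PosDef) :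
    klDiv' (gaussianMeasure m S) (gaussianMeasure m' T) =
      ∫ x, (Real.log (gaussianDensity m S x) - Real.log (gaussianDensity m' T x))
        ∂(gaussianMeasure m S) := by
  have hp := isProbabilityMeasure_gaussianMeasure m hS
  have hmeas (c : Fin D → ℝ) (M : Matrix (Fin D) (Fin D) ℝ) :
      Measurable fun x => ENNReal.ofReal (gaussianDensity c M x) :=
    (continuous_gaussianDensity c M).measurable.ennreal_ofReal
  have hright : (gaussianMeasure m S).rnDeriv (gaussianMeasure m' T) =ᵐ[volume]
      fun x => (ENNReal.ofReal (gaussianDensity m' T x))⁻¹ *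
        (gaussianMeasure m S).rnDeriv volume x :=
    Measure.rnDeriv_withDensity_right _ _ (hmeas m' T).aemeasurable
      (ae_of_all _ fun x => (ENNReal.ofReal_pos.mpr (gaussianDensity_pos m' hT x)).ne')
      (ae_of_all _ fun x => ENNReal.ofReal_ne_top)
  have hleft : (gaussianMeasure m S).rnDeriv volume =ᵐ[volume]
      fun x => ENNReal.ofReal (gaussianDensity m S x) :=
    Measure.rnDeriv_withDensity _ (hmeas m S)
  have hac : gaussianMeasure m S ≪ volume := withDensity_absolutelyContinuous _ _
  refine integral_congr_ae ?_
  filter_upwards [hac.ae_le hright, hac.ae_le hleft] with x hx hx'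
  have h1 := gaussianDensity_pos m hS x
  have h2 := gaussianDensity_pos m' hT x
  rw [hx, hx', ENNReal.toReal_mul, ENNReal.toReal_inv, ENNReal.toReal_ofReal h1.le,
    ENNReal.toReal_ofReal h2.le, Real.log_mul (inv_ne_zero h2.ne') h1.ne', Real.log_inv]
  ring

/-- Gaussians with the same mean and the same variances integrate diagonal quadratic forms to the
same value. -/
lemma integral_diagonal_quadratic_gaussianMeasure_congr (m c d : Fin D → ℝ) (hS : S.PosDef)
    (hT : T.PosDef) (h : ∀ i, S i i = T i i) :
    ∫ x, dotProduct (x - c) (diagonal d *ᵥ (x - c)) ∂(gaussianMeasure m S) =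
      ∫ x, dotProduct (x - c) (diagonal d *ᵥ (x - c)) ∂(gaussianMeasure m T) := by
  have key {R : Matrix (Fin D) (Fin D) ℝ} (hR : R.PosDef) :
      ∫ x, dotProduct (x - c) (diagonal d *ᵥ (x - c)) ∂(gaussianMeasure m R) =
        ∑ i, ∫ y, (y - c i) * (d i * (y - c i))
          ∂(ProbabilityTheory.gaussianReal (m i) (R i i).toNNReal) := by
    have := isProbabilityMeasure_gaussianMeasure m hR
    have hmem (i : Fin D) : MemLp (fun x => x i - c i) 2 (gaussianMeasure m R) :=
      (memLp_eval_gaussianMeasure m hR i).sub (memLp_const (c i))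
    simp only [dotProduct, mulVec_diagonal, Pi.sub_apply]
    have hint (i : Fin D) : Integrable (fun x => (x i - c i) * (d i * (x i - c i)))
        (gaussianMeasure m R) := (hmem i).integrable_mul ((hmem i).const_mul (d i))
    rw [integral_finsetSum _ fun i _ => hint i]
    refine Finset.sum_congr rfl fun i _ => ?_
    rw [← (measurePreserving_eval_gaussianMeasure m hR i).map_eq,
      integral_map (measurable_pi_apply i).aemeasurable (by fun_prop)]
  simp_rw [key hS, key hT, h]

/-- Gaussians with the same mean and the same variances give the same expected log-density of a
Gaussian with diagonal covariance. -/
lemma integral_log_gaussianDensity_diagonal_congr (m c : Fin D → ℝ) {d : Fin D → ℝ}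
    (hS : S.PosDef) (hT : T.PosDef) (hd : (diagonal d).PosDef) (h : ∀ i, S i i = T i i) :
    ∫ x, Real.log (gaussianDensity c (diagonal d) x) ∂(gaussianMeasure m S) =
      ∫ x, Real.log (gaussianDensity c (diagonal d) x) ∂(gaussianMeasure m T) := by
  have := isProbabilityMeasure_gaussianMeasure m hS
  have := isProbabilityMeasure_gaussianMeasure m hT
  simp_rw [log_gaussianDensity c hd]
  rw [integral_sub (integrable_const _)
      ((integrable_quadratic_gaussianMeasure m hS c _).const_mul _),
    integral_sub (integrable_const _)
      ((integrable_quadratic_gaussianMeasure m hT c _).const_mul _),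
    integral_const_mul, integral_const_mul, inv_diagonal,
    integral_diagonal_quadratic_gaussianMeasure_congr m c _ hS hT h]
  simp

end Gaussian

/-- The KL divergence of `N(m, Σ)` to the standard normal decomposes as the divergence to the
Gaussian with the same mean and diagonal covariance `Diag(Σ)`, plus the divergence of that
diagonal Gaussian to the standard normal. -/
theorem kl_gaussian_diag_decomposition {D : ℕ} (m : Fin D → ℝ)
    (S : Matrix (Fin D) (Fin D) ℝ) (hS : S.PosDef) :
    klDiv' (gaussianMeasure m S) (gaussianMeasure 0 1) =
      klDiv' (gaussianMeasure m S) (gaussianMeasure m (Matrix.diagonal fun i => S i i)) +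
        klDiv' (gaussianMeasure m (Matrix.diagonal fun i => S i i)) (gaussianMeasure 0 1) := by
  have hd : (Matrix.diagonal fun i => S i i).PosDef :=
    PosDef.diagonal fun i => hS.diag_pos
  have h1 : (1 : Matrix (Fin D) (Fin D) ℝ).PosDef := PosDef.one
  have hone := integral_log_gaussianDensity_diagonal_congr m 0 (d := fun _ => 1) hS hd
    (by simpa using h1) (by simp)
  rw [diagonal_one] at hone
  rw [klDiv'_gaussianMeasure _ _ hS h1, klDiv'_gaussianMeasure _ _ hS hd,
    klDiv'_gaussianMeasure _ _ hd h1,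
    integral_sub (integrable_log_gaussianDensity _ _ hS hS)
      (integrable_log_gaussianDensity _ _ hS h1),
    integral_sub (integrable_log_gaussianDensity _ _ hS hS)
      (integrable_log_gaussianDensity _ _ hS hd),
    integral_sub (integrable_log_gaussianDensity _ _ hd hd)
      (integrable_log_gaussianDensity _ _ hd h1),
    hone, integral_log_gaussianDensity_diagonal_congr m m hS hd hd (by simp)]
  ring
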